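/- Let d ≥ 2 be an integer and let A, B ∈ M_{d²}(ℂ) have (unique) Pauli expansions A = ∑_{r,s,r',s'} α(r,s,r',s') P_{r,s} ⊗ P_{r',s'} and B = ∑_{r,s,r',s'} β(r,s,r',s') P_{r,s} ⊗ P_{r',s'} with complex coefficients α, β indexed by (ℤ/dℤ)⁴. Then for every ρ ∈ M_{d²}(ℂ): (1/d⁴) ∑_{r,s,r',s'} (P_{r,s} ⊗ P_{r',s'})† A (P_{r,s} ⊗ P_{r',s'}) ρ (P_{r,s} ⊗ P_{r',s'})† B (P_{r,s} ⊗ P_{r',s'}) = ∑_{r,s,r',s'} γ_{r,s,r',s'} (P_{r,s} ⊗ P_{r',s'}) ρ (P_{r,s} ⊗ P_{r',s'})†, where γ_{r,s,r',s'} := ω^{rs + r's'} α(r,s,r',s') β(−r,−s,−r',−s') and −x denotes the additive inverse modulo d. In other words, twirling the map ρ ↦ AρB over the phase-free two-qudit Pauli operators yields a Pauli channel with these coefficients. -/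

import Mathlib

open Matrix Complex
open scoped Kronecker BigOperators ComplexOrder

noncomputable section

/-- `ω = exp(2πi/d)`. -/
def omega (d : ℕ) : ℂ := Complex.exp (2 * Real.pi * Complex.I / d)

/-- The generalized Pauli `X` matrix on `ℂ^d`: `X = ∑_j |j⟩⟨j ⊕ 1|`. -/
def Xmat (d : ℕ) : Matrix (ZMod d) (ZMod d) ℂ :=
  Matrix.of fun j k => if k = j + 1 then 1 else 0

/-- The generalized Pauli `Z` matrix on `ℂ^d`: `Z = ∑_j ω^j |j⟩⟨j|`. -/
def Zmat (d : ℕ) : Matrix (ZMod d) (ZMod d) ℂ :=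
  Matrix.of fun j k => if j = k then omega d ^ j.val else 0

variable (d : ℕ) [NeZero d]

/-- `P_{r,s} = X^r Z^s`. -/
def Pauli (r s : ZMod d) : Matrix (ZMod d) (ZMod d) ℂ :=
  Xmat d ^ r.val * Zmat d ^ s.val

/-- Phase-free two-qudit Pauli operator `P_{r,s} ⊗ P_{r',s'}`. -/
def Pauli2 (r s r' s' : ZMod d) :
    Matrix (ZMod d × ZMod d) (ZMod d × ZMod d) ℂ :=
  Pauli d r s ⊗ₖ Pauli d r' s'

/-- The one-qudit Pauli group (as a set of matrices): all `ω^λ P_{r,s}`. -/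
def PauliSet1 : Set (Matrix (ZMod d) (ZMod d) ℂ) :=
  { M | ∃ lam r s : ZMod d, M = omega d ^ lam.val • Pauli d r s }

/-- The two-qudit Pauli group (as a set of matrices): all `ω^λ P_{r,s} ⊗ P_{r',s'}`. -/
def PauliSet2 : Set (Matrix (ZMod d × ZMod d) (ZMod d × ZMod d) ℂ) :=
  { M | ∃ lam r s r' s' : ZMod d, M = omega d ^ lam.val • Pauli2 d r s r' s' }


theorem omega_pow_val (x : ZMod d) : omega d ^ x.val = ZMod.stdAddChar x := by
  rw [omega, ← Complex.exp_nat_mul, ZMod.stdAddChar_apply, ZMod.toCircle_apply]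
  congr 1
  ring

theorem star_stdAddChar (x : ZMod d) :
    star (ZMod.stdAddChar x : ℂ) = ZMod.stdAddChar (-x) := by
  rw [ZMod.stdAddChar_apply, ZMod.stdAddChar_apply, AddChar.map_neg_eq_inv, Circle.coe_inv_eq_conj]
  rfl

theorem Xmat_pow_apply (n : ℕ) (j k : ZMod d) :
    (Xmat d ^ n) j k = if k = j + n then 1 else 0 := by
  induction n generalizing j with
  | zero => simp [Matrix.one_apply, eq_comm]
  | succ n ih =>
    rw [pow_succ', Matrix.mul_apply, Finset.sum_eq_single (j + 1)]
    · rw [ih, Xmat, Matrix.of_apply, if_pos rfl, one_mul, Nat.cast_succ, add_assoc,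
        add_comm (1 : ZMod d)]
    · intro b _ hb
      simp [Xmat, hb]
    · simp

theorem Zmat_eq_diagonal : Zmat d = Matrix.diagonal fun j => ZMod.stdAddChar j := by
  ext j k
  simp [Zmat, Matrix.diagonal_apply, omega_pow_val]

theorem Pauli_apply (r s j k : ZMod d) :
    Pauli d r s j k = if k = j + r then ZMod.stdAddChar (s * k) else 0 := by
  rw [Pauli, Zmat_eq_diagonal, Matrix.diagonal_pow, Matrix.mul_diagonal, Xmat_pow_apply]
  simp [← AddChar.map_nsmul_eq_pow]

theorem Pauli_mul_apply (r s t u j k : ZMod d) :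
    (Pauli d r s * Pauli d t u) j k =
      if k = j + r + t then ZMod.stdAddChar (s * (j + r) + u * k) else 0 := by
  rw [Matrix.mul_apply, Finset.sum_eq_single (j + r)]
  · simp [Pauli_apply, AddChar.map_add_eq_mul]
  · intro b _ hb
    simp [Pauli_apply, hb]
  · simp

theorem Pauli_neg (r s : ZMod d) :
    Pauli d (-r) (-s) = (ZMod.stdAddChar (r * s) : ℂ) • star (Pauli d r s) := by
  ext j k
  have h : k = j + -r ↔ j = k + r := by grind
  simp only [Matrix.smul_apply, Matrix.star_apply, Pauli_apply, smul_eq_mul, h]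
  split_ifs with hj
  · rw [star_stdAddChar, ← AddChar.map_add_eq_mul, hj]
    congr 1
    ring
  · simp

theorem star_Pauli_mul_self (r s : ZMod d) : star (Pauli d r s) * Pauli d r s = 1 := by
  have h : star (Pauli d r s) = (ZMod.stdAddChar (-(r * s)) : ℂ) • Pauli d (-r) (-s) := by
    rw [Pauli_neg, smul_smul, ← AddChar.map_add_eq_mul]
    simp
  ext j k
  rw [h, Matrix.smul_mul, Matrix.smul_apply, Pauli_mul_apply, Matrix.one_apply]
  by_cases hk : j = k
  · subst hk
    simp only [neg_add_cancel_right, if_true, smul_eq_mul, ← AddChar.map_add_eq_mul]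
    rw [← AddChar.map_zero_eq_one (ZMod.stdAddChar (N := d))]
    congr 1
    ring
  · simp [hk, Ne.symm hk]

theorem Pauli_mul_comm (r s t u : ZMod d) :
    Pauli d t u * Pauli d r s =
      (ZMod.stdAddChar (s * t - r * u) : ℂ) • (Pauli d r s * Pauli d t u) := by
  ext j k
  rw [Matrix.smul_apply, Pauli_mul_apply, Pauli_mul_apply, add_right_comm j t r]
  split_ifs with hk
  · rw [smul_eq_mul, ← AddChar.map_add_eq_mul, hk]
    congr 1
    ring
  · simp

theorem Pauli_conj (r s t u : ZMod d) :
    star (Pauli d r s) * Pauli d t u * Pauli d r s =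
      (ZMod.stdAddChar (s * t - r * u) : ℂ) • Pauli d t u := by
  rw [Matrix.mul_assoc, Pauli_mul_comm, Matrix.mul_smul, ← Matrix.mul_assoc,
    star_Pauli_mul_self, Matrix.one_mul]

theorem star_Pauli2 (r s r' s' : ZMod d) :
    star (Pauli2 d r s r' s') = star (Pauli d r s) ⊗ₖ star (Pauli d r' s') :=
  Matrix.conjTranspose_kronecker _ _

theorem Pauli2_conj (r s r' s' t u t' u' : ZMod d) :
    star (Pauli2 d r s r' s') * Pauli2 d t u t' u' * Pauli2 d r s r' s' =
      (ZMod.stdAddChar (s * t - r * u + (s' * t' - r' * u')) : ℂ) • Pauli2 d t u t' u' := by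
  rw [star_Pauli2]
  simp only [Pauli2]
  rw [← Matrix.mul_kronecker_mul, ← Matrix.mul_kronecker_mul, Pauli_conj, Pauli_conj,
    Matrix.smul_kronecker, Matrix.kronecker_smul, smul_smul, AddChar.map_add_eq_mul]

theorem Pauli2_neg (r s r' s' : ZMod d) :
    Pauli2 d (-r) (-s) (-r') (-s') =
      (ZMod.stdAddChar (r * s + r' * s') : ℂ) • star (Pauli2 d r s r' s') := by
  rw [star_Pauli2, Pauli2, Pauli_neg, Pauli_neg, Matrix.smul_kronecker, Matrix.kronecker_smul,
    smul_smul, AddChar.map_add_eq_mul]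

theorem sum_stdAddChar_mul (a : ZMod d) :
    ∑ x : ZMod d, (ZMod.stdAddChar (x * a) : ℂ) = if a = 0 then (d : ℂ) else 0 := by
  simpa [ZMod.card] using AddChar.sum_mulShift a (ZMod.isPrimitive_stdAddChar d)

theorem sum_symplectic_character (t u t' u' : ZMod d) :
    ∑ p : ZMod d × ZMod d × ZMod d × ZMod d,
        (ZMod.stdAddChar (p.2.1 * t - p.1 * u + (p.2.2.2 * t' - p.2.2.1 * u')) : ℂ) =
      if (t, u, t', u') = 0 then (d : ℂ) ^ 4 else 0 := by
  have h (p : ZMod d × ZMod d × ZMod d × ZMod d) :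
      (ZMod.stdAddChar (p.2.1 * t - p.1 * u + (p.2.2.2 * t' - p.2.2.1 * u')) : ℂ) =
        ZMod.stdAddChar (p.1 * -u) * (ZMod.stdAddChar (p.2.1 * t) *
          (ZMod.stdAddChar (p.2.2.1 * -u') * ZMod.stdAddChar (p.2.2.2 * t'))) := by
    simp only [← AddChar.map_add_eq_mul]
    congr 1
    ring
  simp only [h, Fintype.sum_prod_type, ← Finset.mul_sum, ← Finset.sum_mul, sum_stdAddChar_mul,
    neg_eq_zero, Prod.mk_eq_zero]
  by_cases hu : u = 0 <;> by_cases ht : t = 0 <;> by_cases hu' : u' = 0 <;>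
    by_cases ht' : t' = 0 <;> simp [hu, ht, hu', ht']
  ring

/-- Twirling `x ↦ a x b` over a finite family `U` on which conjugation acts by characters `χ`
satisfying the orthogonality relation. -/
theorem twirl_of_orthogonal {ι R : Type*} [Fintype ι] [DecidableEq ι] [AddGroup ι]
    [Ring R] [Algebra ℂ R] [Star R] (U : ι → R) (χ : ι → ι → ℂ) (c : ι → ℂ) (N : ℂ) (hN : N ≠ 0)
    (hconj : ∀ p q, star (U p) * U q * U p = χ p q • U q)
    (horth : ∀ q q', ∑ p, χ p q * χ p q' = if q' = -q then N else 0)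
    (hneg : ∀ q, U (-q) = c q • star (U q)) (α β : ι → ℂ) (x : R) :
    N⁻¹ • ∑ p, star (U p) * (∑ q, α q • U q) * U p * x * star (U p) * (∑ q, β q • U q) * U p =
      ∑ q, (c q * α q * β (-q)) • (U q * x * star (U q)) := by
  have hsum (γ : ι → ℂ) (p : ι) :
      star (U p) * (∑ q, γ q • U q) * U p = ∑ q, (γ q * χ p q) • U q := by
    simp only [Finset.mul_sum, Finset.sum_mul, mul_smul_comm, smul_mul_assoc, hconj, smul_smul]
  have hterm (p : ι) :
      star (U p) * (∑ q, α q • U q) * U p * x * star (U p) * (∑ q, β q • U q) * U p =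
        ∑ q, ∑ q', (χ p q * χ p q') • ((α q * β q') • (U q * x * U q')) := by
    rw [hsum, mul_assoc _ (star (U p)), mul_assoc _ (star (U p) * _), hsum]
    simp only [Finset.sum_mul, Finset.mul_sum, Finset.smul_sum, smul_mul_assoc, mul_smul_comm,
      smul_smul]
    rw [Finset.sum_comm]
    refine Finset.sum_congr rfl fun q _ => Finset.sum_congr rfl fun q' _ => ?_
    congr 1
    ring
  simp only [hterm]
  rw [Finset.sum_comm, Finset.smul_sum]
  refine Finset.sum_congr rfl fun q _ => ?_
  rw [Finset.sum_comm]
  simp only [← Finset.sum_smul, horth, ite_smul, zero_smul, Finset.sum_ite_eq', Finset.mem_univ,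
    if_true]
  rw [hneg, mul_smul_comm, smul_smul, smul_smul, smul_smul]
  congr 1
  field_simp

/-- Twirling the map `ρ ↦ AρB` over the `d⁴` phase-free two-qudit Pauli
operators yields a Pauli channel with coefficients
`γ_{r,s,r',s'} = ω^{rs + r's'} α(r,s,r',s') β(−r,−s,−r',−s')`. -/
theorem pauli_twirl_is_pauli_channel (d : ℕ) [NeZero d] (hd : 2 ≤ d)
    (α β : ZMod d → ZMod d → ZMod d → ZMod d → ℂ)
    (A B : Matrix (ZMod d × ZMod d) (ZMod d × ZMod d) ℂ)
    (hA : A = ∑ r : ZMod d, ∑ s : ZMod d, ∑ r' : ZMod d, ∑ s' : ZMod d,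
      α r s r' s' • Pauli2 d r s r' s')
    (hB : B = ∑ r : ZMod d, ∑ s : ZMod d, ∑ r' : ZMod d, ∑ s' : ZMod d,
      β r s r' s' • Pauli2 d r s r' s')
    (ρ : Matrix (ZMod d × ZMod d) (ZMod d × ZMod d) ℂ) :
    ((d : ℂ) ^ 4)⁻¹ • ∑ r : ZMod d, ∑ s : ZMod d, ∑ r' : ZMod d, ∑ s' : ZMod d,
        star (Pauli2 d r s r' s') * A * Pauli2 d r s r' s' * ρ *
          star (Pauli2 d r s r' s') * B * Pauli2 d r s r' s'
      = ∑ r : ZMod d, ∑ s : ZMod d, ∑ r' : ZMod d, ∑ s' : ZMod d,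
          (omega d ^ (r * s + r' * s' : ZMod d).val * α r s r' s' *
              β (-r) (-s) (-r') (-s')) •
            (Pauli2 d r s r' s' * ρ * star (Pauli2 d r s r' s')) := by
  have hd0 : (d : ℂ) ^ 4 ≠ 0 := pow_ne_zero _ (Nat.cast_ne_zero.mpr (NeZero.ne d))
  have h := twirl_of_orthogonal
    (fun p : ZMod d × ZMod d × ZMod d × ZMod d => Pauli2 d p.1 p.2.1 p.2.2.1 p.2.2.2)
    (fun p q => ZMod.stdAddChar
      (p.2.1 * q.1 - p.1 * q.2.1 + (p.2.2.2 * q.2.2.1 - p.2.2.1 * q.2.2.2)))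
    (fun q => ZMod.stdAddChar (q.1 * q.2.1 + q.2.2.1 * q.2.2.2))
    ((d : ℂ) ^ 4) hd0 (fun p q => Pauli2_conj d _ _ _ _ _ _ _ _)
    (fun q q' => by
      have hq : (q' = -q) = (q + q' = 0) := propext (by rw [add_comm, add_eq_zero_iff_eq_neg])
      simp only [hq]
      refine Eq.trans (Finset.sum_congr rfl fun p _ => ?_)
        (sum_symplectic_character d (q.1 + q'.1) (q.2.1 + q'.2.1) (q.2.2.1 + q'.2.2.1)
          (q.2.2.2 + q'.2.2.2))
      rw [← AddChar.map_add_eq_mul]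
      congr 1
      ring)
    (fun q => Pauli2_neg d _ _ _ _)
    (fun q => α q.1 q.2.1 q.2.2.1 q.2.2.2) (fun q => β q.1 q.2.1 q.2.2.1 q.2.2.2) ρ
  simp only [Fintype.sum_prod_type, Prod.fst_neg, Prod.snd_neg, ← hA, ← hB] at h
  simpa only [omega_pow_val] using h
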